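/- Let p,q > 1 satisfy 1/p + 1/q < 2/d if d ≥ 2. Then for every ω ∈ Ω* ∩ Ω_{p,q}, the random walk has zero speed: X_n/n → 0 in P_ω^0-probability as n → ∞. -/

import Mathlib

open MeasureTheory Filter Topology Matrix
open scoped ENNReal NNReal

noncomputable section

namespace DetCond

/-- Vertices of `ℤ^d`. -/
abbrev Vert (d : ℕ) := Fin d → ℤ

/-- Index of the (unordered) nearest-neighbour edge `(x, x + e i)` of `ℤ^d`;
the set of these indices is in natural bijection with `E(ℤ^d)` modulo orientation. -/
abbrev EdgeIx (d : ℕ) := Vert d × Fin d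

/-- The space `Ω = (0,∞)^{E(ℤ^d)}` of (symmetric) conductance configurations, with
its product topology and product σ-algebra. -/
abbrev EnvSp (d : ℕ) := {ω : EdgeIx d → ℝ // ∀ e, 0 < ω e}

/-- The `i`-th coordinate unit vector of `ℤ^d`. -/
def unitv (d : ℕ) (i : Fin d) : Vert d := fun j => if j = i then 1 else 0

/-- The translation `τ_x` acting on environments: `c_{τ_x ω}(y,z) = c_ω(y+x,z+x)`. -/
def shift (d : ℕ) (x : Vert d) (ω : EnvSp d) : EnvSp d :=
  ⟨fun e => ω.1 (e.1 + x, e.2), fun e => ω.2 (e.1 + x, e.2)⟩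

/-- The conductance `c_ω(x,y)`; it vanishes when `x,y` are not nearest neighbours
and is symmetric in `x,y` by construction. -/
def cnd (d : ℕ) (ω : EnvSp d) (x y : Vert d) : ℝ :=
  ∑ i, ((if y = x + unitv d i then ω.1 (x, i) else 0) +
        (if x = y + unitv d i then ω.1 (y, i) else 0))

/-- `π_ω(x) = Σ_{z : (x,z) ∈ E(ℤ^d)} c_ω(x,z)`. -/
def piOf (d : ℕ) (ω : EnvSp d) (x : Vert d) : ℝ :=
  ∑ i, (ω.1 (x, i) + ω.1 (x - unitv d i, i))

/-- The box `Λ_r = [-r,r]^d ∩ ℤ^d`. -/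
def box (d : ℕ) (r : ℝ) : Finset (Vert d) :=
  Fintype.piFinset fun _ : Fin d => Finset.Icc ⌈-r⌉ ⌊r⌋

/-- The nearest neighbours of `x` in `ℤ^d`. -/
def nbrs (d : ℕ) (x : Vert d) : Finset (Vert d) :=
  (Finset.univ.image fun i => x + unitv d i) ∪ (Finset.univ.image fun i => x - unitv d i)

/-- The set `E(Λ)` of edges incident with at least one vertex of `Λ`
(one index per unordered edge). -/
def edgesIn (d : ℕ) (Λ : Finset (Vert d)) : Finset (EdgeIx d) :=
  Λ.biUnion fun x =>
    (Finset.univ.image fun i => (x, i)) ∪ (Finset.univ.image fun i => (x - unitv d i, i))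

/-- Bounded functions on `Ω`. -/
def IsBdd (d : ℕ) (f : EnvSp d → ℝ) : Prop := ∃ M, ∀ ω, |f ω| ≤ M

/-- Local functions: `f` depends only on the coordinates in some finite set `B` of edges
and, viewed as a function of those coordinates, has compact support in `(0,∞)^B`. -/
def IsLocalFn (d : ℕ) (f : EnvSp d → ℝ) : Prop :=
  ∃ B : Finset (EdgeIx d),
    (∀ ω₁ ω₂ : EnvSp d, (∀ e ∈ B, ω₁.1 e = ω₂.1 e) → f ω₁ = f ω₂) ∧
    ∃ a b : ℝ, 0 < a ∧ ∀ ω : EnvSp d, (∃ e ∈ B, ω.1 e < a ∨ b < ω.1 e) → f ω = 0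

/-- `ℓ_ω(f) = L`, i.e. the block averages of the translates of `f` converge to `L`. -/
def avgTo (d : ℕ) (ω : EnvSp d) (f : EnvSp d → ℝ) (L : ℝ) : Prop :=
  Tendsto (fun n : ℕ => (∑ x ∈ box d (n : ℝ), f (shift d x ω)) / ((box d (n : ℝ)).card : ℝ))
    atTop (𝓝 L)

/-- `ω` is averaging: `ℓ_ω(f)` exists for every continuous local `f`. -/
def Averaging (d : ℕ) (ω : EnvSp d) : Prop :=
  ∀ f : EnvSp d → ℝ, Continuous f → IsLocalFn d f → ∃ L, avgTo d ω f L

/-- `ω` is tempered, i.e. `ω ∈ Ω'`. -/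
def Tempered (d : ℕ) (ω : EnvSp d) : Prop :=
  Tendsto (fun ε : ℝ =>
      limsup (fun n : ℕ =>
        (∑ e ∈ edgesIn d (box d (n : ℝ)),
            (if ε ≤ ω.1 e ∧ ω.1 e ≤ ε⁻¹ then (0:ℝ) else 1)) / (n : ℝ) ^ d) atTop)
    (𝓝[>] 0) (𝓝 0)

/-- `P` is the measure `ℙ_ω` associated with an averaging tempered `ω`:
the unique probability measure whose expectation of every bounded continuous function
is the corresponding block-average limit `ℓ_ω(f)`. -/
def IsEnvLaw (d : ℕ) (ω : EnvSp d) (P : Measure (EnvSp d)) : Prop :=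
  IsProbabilityMeasure P ∧
    ∀ f : EnvSp d → ℝ, Continuous f → IsBdd d f → avgTo d ω f (∫ ω', f ω' ∂P)

/-- Ergodicity of a measure on `Ω` with respect to the translations of `ℤ^d`. -/
def ErgodicEnv (d : ℕ) (P : Measure (EnvSp d)) : Prop :=
  ∀ A : Set (EnvSp d), MeasurableSet A → (∀ x : Vert d, shift d x ⁻¹' A = A) →
    P A = 0 ∨ P A = 1

/-- `ω ∈ Ω⋆`: tempered, averaging, and the associated measure `ℙ_ω` is ergodic. -/
def InOmegaStar (d : ℕ) (ω : EnvSp d) : Prop :=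
  Tempered d ω ∧ Averaging d ω ∧
    ∀ P : Measure (EnvSp d), IsEnvLaw d ω P → ErgodicEnv d P

/-- `ω ∈ Ω_{p,q}`. -/
def InOmegaPQ (d : ℕ) (p q : ℝ) (ω : EnvSp d) : Prop :=
  (∃ C : ℝ, ∀ n : ℕ, 1 ≤ n →
      (∑ e ∈ edgesIn d (box d (n : ℝ)), ω.1 e ^ p) / (n : ℝ) ^ d ≤ C) ∧
  (∃ C : ℝ, ∀ n : ℕ, 1 ≤ n →
      (∑ e ∈ edgesIn d (box d (n : ℝ)), ω.1 e ^ (-q)) / (n : ℝ) ^ d ≤ C)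

/-- The path space of the discrete-time walk. -/
abbrev Path (d : ℕ) := ℕ → Vert d

/-- One-step transition probabilities `𝖯_ω(x,y) = c_ω(x,y)/π_ω(x)`. -/
def transP (d : ℕ) (ω : EnvSp d) (x y : Vert d) : ℝ := cnd d ω x y / piOf d ω x

/-- `μ` is the law `P_ω^{x₀}` of the random walk among the conductances `ω`
started at `x₀`: a probability measure on the path space with the prescribed
finite-dimensional (cylinder) probabilities. -/
def IsWalkLaw (d : ℕ) (ω : EnvSp d) (x₀ : Vert d) (μ : Measure (Path d)) : Prop :=
  IsProbabilityMeasure μ ∧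
    ∀ (n : ℕ) (γ : ℕ → Vert d),
      μ {w | ∀ k ≤ n, w k = γ k} =
        (if γ 0 = x₀ then 1 else 0) *
          ∏ k ∈ Finset.range n, ENNReal.ofReal (transP d ω (γ k) (γ (k+1)))

/-- `n`-step transition probabilities of the discrete-time walk. -/
def stepP (d : ℕ) (ω : EnvSp d) : ℕ → Vert d → Vert d → ℝ
  | 0, x, y => if x = y then 1 else 0
  | n+1, x, y => ∑ z ∈ nbrs d x, transP d ω x z * stepP d ω n z y

/-- `P_ω^x(Y_t = y)` for the constant-speed continuous-time walk `Y_t = X_{N(t)}`,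
where `N` is an independent rate-1 Poisson process. -/
def ctP (d : ℕ) (ω : EnvSp d) (t : ℝ) (x y : Vert d) : ℝ :=
  ∑' k : ℕ, Real.exp (-t) * t ^ k / (Nat.factorial k : ℝ) * stepP d ω k x y

/-- The `ℓ¹`-norm of a vertex of `ℤ^d`. -/
def l1 (d : ℕ) (x : Vert d) : ℝ := ∑ i, |(x i : ℝ)|

/-- A vertex of `ℤ^d` regarded as a point of `ℝ^d`. -/
def ivert (d : ℕ) (x : Vert d) : Fin d → ℝ := fun i => (x i : ℝ)

/-- The linearly interpolated diffusively rescaled walk `B^{(n)}`. -/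
def BnProc (d : ℕ) (n : ℕ) (w : Path d) (t : ℝ) : Fin d → ℝ :=
  (Real.sqrt n)⁻¹ •
    (ivert d (w ⌊t * n⌋₊) +
      (t * n - (⌊t * n⌋₊ : ℝ)) • (ivert d (w (⌊t * n⌋₊ + 1)) - ivert d (w ⌊t * n⌋₊)))


/-- The measure `ℚ_ω` obtained from `ℙ_ω` by tilting with `π(0)`. -/
def Qmeas (d : ℕ) (P : Measure (EnvSp d)) : Measure (EnvSp d) :=
  P.withDensity fun ω' => ENNReal.ofReal (piOf d ω' 0 / ∫ ω'', piOf d ω'' 0 ∂P)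

/-- The inner product `⟨f,g⟩_{L²(πμ)}`. -/
def innerP (d : ℕ) (P : Measure (EnvSp d)) (f g : EnvSp d → ℝ) : ℝ :=
  ∫ ω', f ω' * g ω' * piOf d ω' 0 ∂P

/-- The Dirichlet pairing `⟨h, (−L)h⟩_{L²(πμ)}`. -/
def quadL (d : ℕ) (P : Measure (EnvSp d)) (h : EnvSp d → ℝ) : ℝ :=
  ∫ ω', (∑ z ∈ nbrs d 0, cnd d ω' 0 z * (h ω' - h (shift d z ω'))) * h ω' ∂P

/-- The inner product of `L²(ν)`. -/
def innerQ (d : ℕ) (ν : Measure (EnvSp d)) (f g : EnvSp d → ℝ) : ℝ :=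
  ∫ ω', f ω' * g ω' ∂ν

/-- The Dirichlet pairing `⟨h, (−L)h⟩_{L²(ν)}`. -/
def quadQ (d : ℕ) (ν : Measure (EnvSp d)) (h : EnvSp d → ℝ) : ℝ :=
  ∫ ω', ((piOf d ω' 0)⁻¹ *
      ∑ z ∈ nbrs d 0, cnd d ω' 0 z * (h ω' - h (shift d z ω'))) * h ω' ∂ν

/-- The set whose supremum is the variational characterization
`⟨f,(−L)⁻¹f⟩_{L²(ν)} = sup_h [2⟨h,f⟩ − ⟨h,(−L)h⟩]` (over bounded continuous `h`);
`⟨f,(−L)⁻¹f⟩_{L²(ν)} < ∞` means this set is bounded above. -/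
def invPairSet (d : ℕ) (ν : Measure (EnvSp d)) (f : EnvSp d → ℝ) : Set ℝ :=
  {r | ∃ h : EnvSp d → ℝ, Continuous h ∧ IsBdd d h ∧
        r = 2 * innerQ d ν h f - quadQ d ν h}

/-- The function `f(ω) = π_ω(0)⁻¹ ∇⋆(c v)(ω)` built from a vector field `v`. -/
def fDiv (d : ℕ) (v : EnvSp d → Fin d → ℝ) (ω : EnvSp d) : ℝ :=
  (piOf d ω 0)⁻¹ *
    ∑ i, (cnd d ω 0 (unitv d i) * v ω i -
          cnd d ω (-(unitv d i)) 0 * v (shift d (-(unitv d i)) ω) i)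

/-- The inner product of `ℓ²(Λ,π_ω)`. -/
def innerF (d : ℕ) (ω : EnvSp d) (Λ : Finset (Vert d)) (f g : Vert d → ℝ) : ℝ :=
  ∑ x ∈ Λ, f x * g x * piOf d ω x

/-- The pairing `⟨h, (−𝖫_ω)h⟩_{ℓ²(Λ,π_ω)}` for `h` vanishing outside `Λ`. -/
def quadF (d : ℕ) (ω : EnvSp d) (Λ : Finset (Vert d)) (h : Vert d → ℝ) : ℝ :=
  ∑ x ∈ Λ, (∑ z ∈ nbrs d x, cnd d ω x z * (h x - h z)) * h x

/-- `⟨f, (−𝖫_ω)⁻¹_Λ f⟩_{ℓ²(Λ,π_ω)}` via its variational characterization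
`sup_h [2⟨h,f⟩ − ⟨h,(−𝖫_ω)h⟩]` over `h ∈ ℓ²(Λ,π_ω)`. -/
def invPairF (d : ℕ) (ω : EnvSp d) (Λ : Finset (Vert d)) (f : Vert d → ℝ) : ℝ :=
  sSup {r | ∃ h : Vert d → ℝ, (∀ x ∉ Λ, h x = 0) ∧
      r = 2 * innerF d ω Λ h f - quadF d ω Λ h}

/-- The antisymmetric edge function `v∘τ(ω)`: the value assigned to the
edge `(x, x+e_i)` is `v_i(τ_x(ω))`. -/
def efield (d : ℕ) (v : EnvSp d → Fin d → ℝ) (ω : EnvSp d) : Vert d → Fin d → ℝ :=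
  fun x i => v (shift d x ω) i

/-- The discrete gradient `∇h` of `h : ℤ^d → ℝ` as an edge function. -/
def dgradE (d : ℕ) (h : Vert d → ℝ) : Vert d → Fin d → ℝ :=
  fun x i => h (x + unitv d i) - h x

/-- The inner product `⟨u,w⟩_{ℓ²(E(Λ), c_ω)}` of (antisymmetric) edge functions;
each unordered edge is counted once, which agrees with the paper's sum over
ordered edges carrying the factor ½. -/
def einner (d : ℕ) (ω : EnvSp d) (Λ : Finset (Vert d)) (u w : Vert d → Fin d → ℝ) : ℝ :=
  ∑ e ∈ edgesIn d Λ, u e.1 e.2 * w e.1 e.2 * ω.1 e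

/-- The Dirichlet energy `𝓔_Λ^ω(v)`. -/
def direnergy (d : ℕ) (ω : EnvSp d) (Λ : Finset (Vert d)) (v : EnvSp d → Fin d → ℝ) : ℝ :=
  sInf {r | ∃ h : Vert d → ℝ, (∀ x ∉ Λ, h x = 0) ∧
      r = einner d ω Λ (fun x i => efield d v ω x i - dgradE d h x i)
            (fun x i => efield d v ω x i - dgradE d h x i)}

/-- The gradient `∇h` of a function on `Ω`. -/
def gradOmega (d : ℕ) (h : EnvSp d → ℝ) : EnvSp d → Fin d → ℝ :=
  fun ω i => h (shift d (unitv d i) ω) - h ω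

/-- The inner product `⟨u, c w⟩_{L²(P,ℝ^d)}`. -/
def cinnerP (d : ℕ) (P : Measure (EnvSp d)) (u w : EnvSp d → Fin d → ℝ) : ℝ :=
  ∑ i, ∫ ω', cnd d ω' 0 (unitv d i) * u ω' i * w ω' i ∂P

/-- Bounded vector fields on `Ω`. -/
def IsBddV (d : ℕ) (v : EnvSp d → Fin d → ℝ) : Prop := ∃ M, ∀ ω i, |v ω i| ≤ M

/-- The space `𝒱 = (ℝ^d)^{ℤ^d}` of vector fields on `ℤ^d`. -/
abbrev VS (d : ℕ) := Vert d → Fin d → ℝ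

/-- The empirical measures `μ_r^{ω,v}` built from the minimizers `h_r` of the
finite-volume Dirichlet energies. -/
def muR (d : ℕ) (ω : EnvSp d) (hr : ℕ → Vert d → ℝ) (r : ℕ) :
    Measure (EnvSp d × VS d) :=
  (((box d ((r : ℝ) + Real.sqrt r)).card : ℝ≥0∞) *
      ((box d (Real.sqrt r)).card : ℝ≥0∞))⁻¹ •
    ∑ z ∈ box d (Real.sqrt r), ∑ x ∈ box d ((r : ℝ) + Real.sqrt r),
      Measure.dirac (shift d (x + z) ω, fun y => dgradE d (hr r) (x + z + y))

/-- The localized conductances `c_ω^R`. -/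
def cR (d : ℕ) (ω : EnvSp d) (R : ℝ) (e : EdgeIx d) : ℝ :=
  if e ∈ edgesIn d (box d (2 * R)) then ω.1 e else 1

/-- The localized measure `π_ω^R`. -/
def piRloc (d : ℕ) (ω : EnvSp d) (R : ℝ) (x : Vert d) : ℝ :=
  if x ∈ box d (2 * R) then piOf d ω x
  else if x ∈ box d (4 * R) then 1 + piOf d ω x else 1

/-- The localized Dirichlet form `D_ω^R(f,f)` (each unordered edge counted once). -/
def DR (d : ℕ) (ω : EnvSp d) (R : ℝ) (f : Vert d → ℝ) : ℝ≥0∞ :=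
  ∑' e : EdgeIx d, ENNReal.ofReal (cR d ω R e * (f (e.1 + unitv d e.2) - f e.1) ^ 2)

/-- The norm `‖f‖_{ℓ^s(μ)}`. -/
def lpN (d : ℕ) (μw : Vert d → ℝ) (s : ℝ) (f : Vert d → ℝ) : ℝ≥0∞ :=
  (∑' x : Vert d, ENNReal.ofReal (|f x| ^ s * μw x)) ^ (1 / s)

/-- The exponent `ε = 2(2/d − 1/p − 1/q)((d−2)/d + 1/q)⁻¹`. -/
def epsPQ (d : ℕ) (p q : ℝ) : ℝ :=
  2 * (2 / (d : ℝ) - 1 / p - 1 / q) / (((d : ℝ) - 2) / (d : ℝ) + 1 / q)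

/-- Jump rates of the localized constant-speed chain `Y^R`:
rate `c_ω^R(x,y)/π_ω^R(x)` from `x` to `y`. -/
def rateR (d : ℕ) (ω : EnvSp d) (R : ℝ) (x y : Vert d) : ℝ :=
  (∑ i, ((if y = x + unitv d i then cR d ω R (x, i) else 0) +
         (if x = y + unitv d i then cR d ω R (y, i) else 0))) / piRloc d ω R x

/-- The generator matrix of `Y^R`. -/
def qmatR (d : ℕ) (ω : EnvSp d) (R : ℝ) (x y : Vert d) : ℝ :=
  if x = y then -(∑ z ∈ nbrs d x, rateR d ω R x z) else rateR d ω R x y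

/-- Iterates of the generator matrix of `Y^R`. -/
def qiter (d : ℕ) (ω : EnvSp d) (R : ℝ) : ℕ → Vert d → Vert d → ℝ
  | 0, x, y => if x = y then 1 else 0
  | n+1, x, y => ∑ z ∈ insert x (nbrs d x), qmatR d ω R x z * qiter d ω R n z y

/-- The heat kernel `P_ω^x(Y_t^R = y) = (e^{tQ})(x,y)` of the localized chain `Y^R`. -/
def hkR (d : ℕ) (ω : EnvSp d) (R : ℝ) (t : ℝ) (x y : Vert d) : ℝ :=
  ∑' k : ℕ, t ^ k / (Nat.factorial k : ℝ) * qiter d ω R k x y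

section Contraction

open Polynomial

variable {E : Type*} [NormedAddCommGroup E] [InnerProductSpace ℝ E]

lemma aeval_chebyshev_add_two_apply (A : E →ₗ[ℝ] E) (u : E) (j : ℤ) :
    aeval A (Chebyshev.T ℝ (j + 2)) u =
      (2 : ℝ) • A (aeval A (Chebyshev.T ℝ (j + 1)) u) - aeval A (Chebyshev.T ℝ j) u := by
  rw [Chebyshev.T_add_two, mul_assoc, show (2 : ℝ[X]) = C 2 from rfl]
  simp

/-- Chebyshev polynomials of a symmetric contraction grow at most linearly; the argument is
conservation of energy for the wave equation `u_{k+2} = 2 A u_{k+1} - u_k`. -/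
lemma norm_aeval_chebyshev_apply_le (A : E →ₗ[ℝ] E) (hA : A.IsSymmetric)
    (hc : ∀ v, ‖A v‖ ≤ ‖v‖) (u : E) (k : ℕ) :
    ‖aeval A (Chebyshev.T ℝ (k : ℤ)) u‖ ≤ (k + 1) * ‖u‖ := by
  set W : ℕ → E := fun k => aeval A (Chebyshev.T ℝ (k : ℤ)) u with hW
  have hrec : ∀ k, W (k + 2) = (2 : ℝ) • A (W (k + 1)) - W k := fun k => by
    simpa [hW] using aeval_chebyshev_add_two_apply A u k
  have h0 : W 0 = u := by simp [hW]
  have h1 : W 1 = A u := by simp [hW]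
  have henergy : ∀ k, ‖W (k + 1) - A (W k)‖ ^ 2 + ‖W k‖ ^ 2 - ‖A (W k)‖ ^ 2 =
      ‖u‖ ^ 2 - ‖A u‖ ^ 2 := by
    intro k
    induction k with
    | zero => simp [h0, h1]
    | succ k ih =>
      rw [← ih, hrec, show (2 : ℝ) • A (W (k + 1)) - W k - A (W (k + 1)) =
        A (W (k + 1)) - W k by rw [two_smul]; abel, norm_sub_sq_real, norm_sub_sq_real,
        hA (W (k + 1)) (W k)]
      ring
  have hstep : ∀ k, ‖W (k + 1)‖ ≤ ‖W k‖ + ‖u‖ := by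
    intro k
    have hv : ‖W (k + 1) - A (W k)‖ ≤ ‖u‖ := by
      refine le_of_sq_le_sq ?_ (norm_nonneg _)
      have h := henergy k
      have h2 := pow_le_pow_left₀ (norm_nonneg _) (hc (W k)) 2
      nlinarith [sq_nonneg ‖A u‖]
    calc ‖W (k + 1)‖ = ‖A (W k) + (W (k + 1) - A (W k))‖ := by congr 1; abel
      _ ≤ ‖A (W k)‖ + ‖W (k + 1) - A (W k)‖ := norm_add_le _ _
      _ ≤ ‖W k‖ + ‖u‖ := add_le_add (hc _) hv
  change ‖W k‖ ≤ _
  induction k with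
  | zero => simp [h0]
  | succ k ih => push_cast; linarith [hstep k]

/-- A Carne-type bound: if the Chebyshev iterates of degree at most `r` of a symmetric
contraction `A` are annihilated by `B` at `u`, then `B (A ^ n u)` is exponentially small. -/
lemma norm_apply_pow_le_of_chebyshev_eq_zero (A B : E →ₗ[ℝ] E) (hA : A.IsSymmetric)
    (hc : ∀ v, ‖A v‖ ≤ ‖v‖) (hB : ∀ v, ‖B v‖ ≤ ‖v‖) (u : E) (r : ℝ)
    (hr : ∀ k : ℕ, (k : ℝ) ≤ r → B (aeval A (Chebyshev.T ℝ (k : ℤ)) u) = 0)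
    (l : ℝ) (hl : 0 < l) (hl1 : l ≤ 1) (n : ℕ) :
    ‖B ((A ^ n) u)‖ ≤ 2 * ‖u‖ / l * Real.exp (-(l * r) + 2 * l ^ 2 * n) := by
  set W : ℤ → E := fun k => aeval A (Chebyshev.T ℝ k) u with hW
  have hrec : ∀ j, A (W j) = (1 / 2 : ℝ) • (W (j + 1) + W (j - 1)) := fun j => by
    have h := aeval_chebyshev_add_two_apply A u (j - 1)
    rw [show j - 1 + 2 = j + 1 by ring, show j - 1 + 1 = j by ring] at h
    simp only [hW]
    rw [h, sub_add_cancel, smul_smul]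
    norm_num
  set K : ℝ := ‖u‖ / l * Real.exp (-(l * r)) with hK
  have hK0 : 0 ≤ K := by positivity
  have hnat : ∀ k : ℕ, ‖B (W k)‖ ≤ K * Real.exp (2 * l * k) := by
    intro k
    by_cases hk : (k : ℝ) ≤ r
    · rw [hr k hk, norm_zero]; positivity
    · have h1 : ‖B (W k)‖ ≤ (k + 1) * ‖u‖ :=
        (hB _).trans (norm_aeval_chebyshev_apply_le A hA hc u k)
      have h2 : (k + 1 : ℝ) ≤ Real.exp (l * k) / l := by
        rw [le_div_iff₀ hl]
        nlinarith [Real.add_one_le_exp (l * k)]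
      have h3 : Real.exp (l * k) ≤ Real.exp (-(l * r)) * Real.exp (2 * l * k) := by
        rw [← Real.exp_add]
        apply Real.exp_le_exp.2
        nlinarith
      calc ‖B (W k)‖ ≤ (k + 1) * ‖u‖ := h1
        _ ≤ Real.exp (l * k) / l * ‖u‖ := by gcongr
        _ ≤ (Real.exp (-(l * r)) * Real.exp (2 * l * k)) / l * ‖u‖ := by gcongr
        _ = K * Real.exp (2 * l * k) := by rw [hK]; ring
  have hint : ∀ j : ℤ, ‖B (W j)‖ ≤ K * (2 * Real.cosh (2 * l * j)) := by
    intro j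
    rw [Real.cosh_eq]
    obtain ⟨k, rfl | rfl⟩ := j.eq_nat_or_neg
    · refine (hnat k).trans ?_
      push_cast
      gcongr
      linarith [Real.exp_pos (-(2 * l * (k : ℝ)))]
    · rw [show W (-(k : ℤ)) = W k by simp only [hW, Chebyshev.T_neg]]
      refine (hnat k).trans ?_
      push_cast
      rw [mul_neg, neg_neg]
      gcongr
      linarith [Real.exp_pos (-(2 * l * (k : ℝ)))]
  have hpow : ∀ (n : ℕ) (j : ℤ), ‖B ((A ^ n) (W j))‖ ≤
      K * (2 * Real.cosh (2 * l * j)) * Real.cosh (2 * l) ^ n := by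
    intro n
    induction n with
    | zero => intro j; simpa using hint j
    | succ n ih =>
      intro j
      have hadd : Real.cosh (2 * l * j + 2 * l) + Real.cosh (2 * l * j - 2 * l) =
          2 * Real.cosh (2 * l * j) * Real.cosh (2 * l) := by
        rw [Real.cosh_add, Real.cosh_sub]; ring
      calc ‖B ((A ^ (n + 1)) (W j))‖
          = ‖(1 / 2 : ℝ) • (B ((A ^ n) (W (j + 1))) + B ((A ^ n) (W (j - 1))))‖ := by
            rw [pow_succ, Module.End.mul_apply, hrec]; simp only [map_smul, map_add]
        _ ≤ 1 / 2 * (‖B ((A ^ n) (W (j + 1)))‖ + ‖B ((A ^ n) (W (j - 1)))‖) := by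
            rw [norm_smul]
            norm_num
            exact norm_add_le _ _
        _ ≤ 1 / 2 * (K * (2 * Real.cosh (2 * l * (j + 1 : ℤ))) * Real.cosh (2 * l) ^ n +
              K * (2 * Real.cosh (2 * l * (j - 1 : ℤ))) * Real.cosh (2 * l) ^ n) := by
            gcongr
            · exact ih _
            · exact ih _
        _ = K * (Real.cosh (2 * l * j + 2 * l) + Real.cosh (2 * l * j - 2 * l)) *
              Real.cosh (2 * l) ^ n := by
            push_cast
            rw [mul_add (2 * l), mul_sub (2 * l), mul_one]
            ring
        _ = K * (2 * Real.cosh (2 * l * j)) * Real.cosh (2 * l) ^ (n + 1) := by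
            rw [hadd]; ring
  have hcosh : Real.cosh (2 * l) ^ n ≤ Real.exp (2 * l ^ 2 * n) := by
    calc Real.cosh (2 * l) ^ n ≤ Real.exp ((2 * l) ^ 2 / 2) ^ n :=
          pow_le_pow_left₀ (Real.cosh_pos _).le (Real.cosh_le_exp_half_sq _) n
      _ = Real.exp (2 * l ^ 2 * n) := by rw [← Real.exp_nat_mul]; congr 1; ring
  have h := hpow n 0
  simp only [hW, Chebyshev.T_zero, map_one, Module.End.one_apply, Int.cast_zero, mul_zero,
    Real.cosh_zero, mul_one] at h
  calc ‖B ((A ^ n) u)‖ ≤ K * 2 * Real.cosh (2 * l) ^ n := h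
    _ ≤ K * 2 * Real.exp (2 * l ^ 2 * n) := by gcongr
    _ = _ := by rw [hK, Real.exp_add]; ring

end Contraction

/-- Gaussian tail bound for a reversible (sub-)Markov chain on a finite state space. -/
lemma sum_tail_le_of_reversible {α : Type*} [Fintype α] [DecidableEq α]
    (c : α → α → ℝ) (ρ : α → ℝ) (hc0 : ∀ x y, 0 ≤ c x y) (hcs : ∀ x y, c x y = c y x)
    (hρ : ∀ x, 0 < ρ x) (hcρ : ∀ x, ∑ y, c x y ≤ ρ x)
    (δ : α → ℕ) (hδ : ∀ x y, c x y ≠ 0 → δ x ≤ δ y + 1) (o : α) (ho : δ o = 0)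
    (n : ℕ) (m : ℕ → α → ℝ) (m0 : ∀ x, m 0 x = if x = o then 1 else 0)
    (hm : ∀ k < n, ∀ y, m (k + 1) y = ∑ x, m k x * (c x y / ρ x))
    (r l : ℝ) (hl : 0 < l) (hl1 : l ≤ 1) :
    ∑ x with r < δ x, m n x ≤
      √((∑ x, ρ x) / ρ o) * (2 / l * Real.exp (-(l * r) + 2 * l ^ 2 * n)) := by
  have hsq : ∀ x, 0 < √(ρ x) := fun x => Real.sqrt_pos.2 (hρ x)
  have hss : ∀ x, √(ρ x) * √(ρ x) = ρ x := fun x => Real.mul_self_sqrt (hρ x).le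
  set a : Matrix α α ℝ := Matrix.of fun x y => c x y / (√(ρ x) * √(ρ y)) with ha
  set A : EuclideanSpace ℝ α →ₗ[ℝ] EuclideanSpace ℝ α := Matrix.toEuclideanLin a with hA
  have hAapp : ∀ v x, (A v) x = ∑ y, a x y * v y := fun v x => rfl
  have hsym : A.IsSymmetric := by
    rw [hA, Matrix.isSymmetric_toEuclideanLin_iff]
    ext x y
    simp [ha, hcs y x, mul_comm]
  have hcontr : ∀ v, ‖A v‖ ≤ ‖v‖ := by
    intro v
    refine le_of_sq_le_sq ?_ (norm_nonneg _)
    rw [EuclideanSpace.norm_sq_eq, EuclideanSpace.norm_sq_eq]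
    simp only [Real.norm_eq_abs, sq_abs]
    have hx : ∀ x, (A v x) ^ 2 ≤ ∑ y, c x y / ρ y * v y ^ 2 := by
      intro x
      rw [hAapp]
      calc (∑ y, a x y * v y) ^ 2
          ≤ (∑ y, c x y / ρ x) * ∑ y, c x y / ρ y * v y ^ 2 := by
            refine Finset.sum_sq_le_sum_mul_sum_of_sq_le_mul _
              (fun y _ => div_nonneg (hc0 x y) (hρ x).le)
              (fun y _ => mul_nonneg (div_nonneg (hc0 x y) (hρ y).le) (sq_nonneg _))
              (fun y _ => le_of_eq ?_)
            simp only [ha, Matrix.of_apply]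
            rw [mul_pow, div_pow, mul_pow, Real.sq_sqrt (hρ x).le, Real.sq_sqrt (hρ y).le]
            ring
        _ ≤ 1 * ∑ y, c x y / ρ y * v y ^ 2 := by
            gcongr
            · exact Finset.sum_nonneg fun y _ =>
                mul_nonneg (div_nonneg (hc0 x y) (hρ y).le) (sq_nonneg _)
            · rw [← Finset.sum_div]
              exact div_le_one_of_le₀ (hcρ x) (hρ x).le
        _ = _ := one_mul _
    calc ∑ x, (A v x) ^ 2 ≤ ∑ x, ∑ y, c x y / ρ y * v y ^ 2 :=
          Finset.sum_le_sum fun x _ => hx x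
      _ = ∑ y, (∑ x, c y x) / ρ y * v y ^ 2 := by
          rw [Finset.sum_comm]
          refine Finset.sum_congr rfl fun y _ => ?_
          rw [Finset.sum_div, Finset.sum_mul]
          exact Finset.sum_congr rfl fun x _ => by rw [hcs]
      _ ≤ ∑ y, v y ^ 2 := by
          refine Finset.sum_le_sum fun y _ => ?_
          have := div_le_one_of_le₀ (hcρ y) (hρ y).le
          nlinarith [sq_nonneg (v y)]
  set b : Matrix α α ℝ := Matrix.diagonal fun x => if r < δ x then 1 else 0 with hb
  set B : EuclideanSpace ℝ α →ₗ[ℝ] EuclideanSpace ℝ α := Matrix.toEuclideanLin b with hBdef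
  have hBapp : ∀ v x, (B v) x = if r < δ x then v x else 0 := by
    intro v x
    have : (B v) x = (b *ᵥ v.ofLp) x := rfl
    rw [this, hb, Matrix.mulVec_diagonal]
    split_ifs <;> simp
  have hBc : ∀ v, ‖B v‖ ≤ ‖v‖ := by
    intro v
    refine le_of_sq_le_sq ?_ (norm_nonneg _)
    rw [EuclideanSpace.norm_sq_eq, EuclideanSpace.norm_sq_eq]
    refine Finset.sum_le_sum fun x _ => ?_
    rw [hBapp]
    split_ifs
    · exact le_rfl
    · simp [sq_nonneg]
  set u : EuclideanSpace ℝ α := EuclideanSpace.single o (1 / √(ρ o)) with hu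
  have hsupp : ∀ k : ℕ, ∀ x, k < δ x →
      (Polynomial.aeval A (Polynomial.Chebyshev.T ℝ (k : ℤ)) u) x = 0 := by
    have hAs : ∀ (k : ℕ) (v : EuclideanSpace ℝ α), (∀ x, k < δ x → v x = 0) →
        ∀ x, k + 1 < δ x → (A v) x = 0 := by
      intro k v hv x hx
      rw [hAapp]
      refine Finset.sum_eq_zero fun y _ => ?_
      by_cases hxy : c x y = 0
      · simp [ha, hxy]
      · rw [hv y (by have := hδ x y hxy; omega), mul_zero]
    have hus : ∀ x, 0 < δ x → u x = 0 := by
      intro x hx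
      have : x ≠ o := by rintro rfl; omega
      simp [hu, this]
    intro k
    induction k using Nat.strong_induction_on with
    | _ k ih =>
      match k, ih with
      | 0, _ => simpa using hus
      | 1, _ => simpa using hAs 0 u hus
      | k + 2, ih =>
        intro x hx
        have h1 := hAs (k + 1) _ (ih (k + 1) (by omega)) x hx
        have h0 := ih k (by omega) x (by omega)
        have h := congrArg (fun v : EuclideanSpace ℝ α => v x)
          (aeval_chebyshev_add_two_apply A u k)
        push_cast at h h1 ⊢
        simpa [h0, h1] using h
  have hr : ∀ k : ℕ, (k : ℝ) ≤ r →
      B (Polynomial.aeval A (Polynomial.Chebyshev.T ℝ (k : ℤ)) u) = 0 := by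
    intro k hk
    ext x
    rw [hBapp]
    split_ifs with hx
    · rw [hsupp k x (by exact_mod_cast hk.trans_lt hx)]; rfl
    · rfl
  have hpow : ∀ k ≤ n, ∀ x, √(ρ x) * ((A ^ k) u) x = m k x := by
    intro k
    induction k with
    | zero =>
      intro _ x
      rw [m0, pow_zero, Module.End.one_apply]
      by_cases hx : x = o
      · subst hx
        simp [hu, (hsq x).ne']
      · simp [hu, hx]
    | succ k ih =>
      intro hk y
      rw [hm k hk, pow_succ', Module.End.mul_apply, hAapp, Finset.mul_sum]
      refine Finset.sum_congr rfl fun x _ => ?_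
      rw [← ih (by omega) x, hcs x y, show c y x / ρ x = c y x / (√(ρ x) * √(ρ x)) by rw [hss]]
      simp only [ha, Matrix.of_apply]
      have := (hsq x).ne'
      have := (hsq y).ne'
      field_simp
  have hnu : ‖u‖ = 1 / √(ρ o) := by
    rw [hu, PiLp.norm_single, Real.norm_eq_abs, abs_of_nonneg (by positivity)]
  have hmain := norm_apply_pow_le_of_chebyshev_eq_zero A B hsym hcontr hBc u r hr l hl hl1 n
  calc ∑ x with r < δ x, m n x = ∑ x, √(ρ x) * (B ((A ^ n) u)) x := by
        rw [Finset.sum_filter]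
        refine Finset.sum_congr rfl fun x _ => ?_
        rw [hBapp, ← hpow n le_rfl x]
        split_ifs <;> simp
    _ ≤ √(∑ x, √(ρ x) ^ 2) * √(∑ x, (B ((A ^ n) u)) x ^ 2) :=
        Real.sum_mul_le_sqrt_mul_sqrt _ _ _
    _ = √(∑ x, ρ x) * ‖B ((A ^ n) u)‖ := by
        rw [EuclideanSpace.norm_eq]
        simp only [Real.norm_eq_abs, sq_abs]
        congr 2
        exact Finset.sum_congr rfl fun x _ => Real.sq_sqrt (hρ x).le
    _ ≤ √(∑ x, ρ x) * (2 * ‖u‖ / l * Real.exp (-(l * r) + 2 * l ^ 2 * n)) := by gcongr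
    _ = _ := by
        rw [hnu, Real.sqrt_div' _ (hρ o).le]
        ring

lemma measure_eq_tsum_inter_preimage_singleton {α β : Type*} [MeasurableSpace α]
    [MeasurableSpace β] [Countable β] [MeasurableSingletonClass β] (μ : Measure α) {f : α → β}
    (hf : Measurable f) {S : Set α} (hS : MeasurableSet S) :
    μ S = ∑' b, μ (S ∩ f ⁻¹' {b}) := by
  rw [← measure_iUnion]
  · congr 1
    ext x
    simp
  · intro b b' hbb
    refine Set.disjoint_left.2 ?_
    rintro x ⟨_, h1⟩ ⟨_, h2⟩
    exact hbb (h1.symm.trans h2)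
  · exact fun b => hS.inter (hf (measurableSet_singleton b))

lemma measurableSet_path_eq (d n : ℕ) (x : Vert d) : MeasurableSet {w : Path d | w n = x} :=
  (measurable_pi_apply (X := fun _ : ℕ => Vert d) n) (measurableSet_singleton x)

/-- The Markov property at a fixed time. -/
lemma IsWalkLaw.measure_pair {d : ℕ} {ω : EnvSp d} {x₀ : Vert d} {μ : Measure (Path d)}
    (hμ : IsWalkLaw d ω x₀ μ) (n : ℕ) (x y : Vert d) :
    μ ({w | w (n + 1) = y} ∩ {w | w n = x}) =
      μ {w | w n = x} * ENNReal.ofReal (transP d ω x y) := by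
  have hH : Measurable fun (w : Path d) (i : Fin n) => w i :=
    measurable_pi_lambda _ fun i => measurable_pi_apply _
  rw [measure_eq_tsum_inter_preimage_singleton μ hH
      ((measurableSet_path_eq d (n + 1) y).inter (measurableSet_path_eq d n x)),
    measure_eq_tsum_inter_preimage_singleton μ hH (measurableSet_path_eq d n x),
    ← ENNReal.tsum_mul_right]
  refine tsum_congr fun g => ?_
  set γ : ℕ → Vert d := fun k => if h : k < n then g ⟨k, h⟩ else if k = n then x else y with hγ
  have hγlt : ∀ i : Fin n, γ i = g i := fun i => by simp [hγ]
  have hγn : γ n = x := by simp [hγ]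
  have hγs : γ (n + 1) = y := by simp [hγ]
  have hn : ({w | w n = x} ∩ (fun (w : Path d) (i : Fin n) => w i) ⁻¹' {g}) =
      {w : Path d | ∀ k ≤ n, w k = γ k} := by
    ext w
    simp only [Set.mem_inter_iff, Set.mem_ofPred_eq, Set.mem_preimage, Set.mem_singleton_iff]
    constructor
    · rintro ⟨hx, hg⟩ k hk
      rcases hk.lt_or_eq with hk | rfl
      · rw [← Fin.val_mk hk, hγlt, ← hg]
      · rw [hx, hγn]
    · intro h
      exact ⟨(h n le_rfl).trans hγn, funext fun i => (h i i.2.le).trans (hγlt i)⟩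
  have hs : ({w | w (n + 1) = y} ∩ {w | w n = x} ∩
      (fun (w : Path d) (i : Fin n) => w i) ⁻¹' {g}) =
      {w : Path d | ∀ k ≤ n + 1, w k = γ k} := by
    rw [Set.inter_assoc, hn]
    ext w
    simp only [Set.mem_inter_iff, Set.mem_ofPred_eq]
    constructor
    · rintro ⟨hy, h⟩ k hk
      rcases hk.lt_or_eq with hk | rfl
      · exact h k (by omega)
      · rw [hy, hγs]
    · exact fun h => ⟨(h _ le_rfl).trans hγs, fun k hk => h k (by omega)⟩
  rw [hs, hn, hμ.2, hμ.2, Finset.prod_range_succ, hγn, hγs, mul_assoc]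

lemma IsWalkLaw.measure_zero {d : ℕ} {ω : EnvSp d} {x₀ : Vert d} {μ : Measure (Path d)}
    (hμ : IsWalkLaw d ω x₀ μ) (x : Vert d) :
    μ {w | w 0 = x} = if x = x₀ then 1 else 0 := by
  simpa using hμ.2 0 fun _ => x

lemma IsWalkLaw.measure_succ {d : ℕ} {ω : EnvSp d} {x₀ : Vert d} {μ : Measure (Path d)}
    (hμ : IsWalkLaw d ω x₀ μ) (n : ℕ) (y : Vert d) :
    μ {w | w (n + 1) = y} = ∑' x, μ {w | w n = x} * ENNReal.ofReal (transP d ω x y) := by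
  rw [measure_eq_tsum_inter_preimage_singleton μ (measurable_pi_apply n)
    (measurableSet_path_eq d (n + 1) y)]
  exact tsum_congr fun x => hμ.measure_pair n x y

/-- The sup-norm of a vertex as a natural number. -/
def supNat (d : ℕ) (x : Vert d) : ℕ := Finset.univ.sup fun i => (x i).natAbs

lemma supNat_le_iff {d : ℕ} {x : Vert d} {k : ℕ} : supNat d x ≤ k ↔ ∀ i, (x i).natAbs ≤ k := by
  simp [supNat]

lemma mem_box_iff {d : ℕ} {x : Vert d} {n : ℕ} : x ∈ box d (n : ℝ) ↔ supNat d x ≤ n := by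
  rw [supNat_le_iff, box, Fintype.mem_piFinset]
  refine forall_congr' fun i => ?_
  rw [Finset.mem_Icc, Int.ceil_neg, Int.floor_natCast]
  omega

lemma norm_ivert (d : ℕ) (x : Vert d) : ‖ivert d x‖ = supNat d x := by
  have hi : ∀ i, ‖ivert d x i‖ = ((x i).natAbs : ℝ) := fun i => by
    simp [ivert, Nat.cast_natAbs]
  refine le_antisymm ?_ ?_
  · refine (pi_norm_le_iff_of_nonneg (Nat.cast_nonneg _)).2 fun i => ?_
    rw [hi]
    exact_mod_cast supNat_le_iff.1 le_rfl i
  · have h : supNat d x ≤ ⌊‖ivert d x‖⌋₊ :=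
      supNat_le_iff.2 fun i => Nat.le_floor (by rw [← hi]; exact norm_le_pi_norm _ i)
    exact (Nat.le_floor_iff (norm_nonneg _)).1 h

lemma cnd_comm (d : ℕ) (ω : EnvSp d) (x y : Vert d) : cnd d ω x y = cnd d ω y x := by
  simp only [cnd]
  exact Finset.sum_congr rfl fun i _ => add_comm _ _

lemma cnd_nonneg (d : ℕ) (ω : EnvSp d) (x y : Vert d) : 0 ≤ cnd d ω x y :=
  Finset.sum_nonneg fun i _ => add_nonneg
    (by split_ifs; exacts [(ω.2 _).le, le_rfl]) (by split_ifs; exacts [(ω.2 _).le, le_rfl])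

lemma piOf_pos (d : ℕ) (hd : 1 ≤ d) (ω : EnvSp d) (x : Vert d) : 0 < piOf d ω x :=
  Finset.sum_pos (fun _ _ => add_pos (ω.2 _) (ω.2 _)) ⟨⟨0, hd⟩, Finset.mem_univ _⟩

lemma sum_cnd_le (d : ℕ) (ω : EnvSp d) (S : Finset (Vert d)) (x : Vert d) :
    ∑ y ∈ S, cnd d ω x y ≤ piOf d ω x := by
  simp only [cnd, piOf]
  rw [Finset.sum_comm]
  refine Finset.sum_le_sum fun i _ => ?_
  rw [Finset.sum_add_distrib]
  have h : ∀ y : Vert d, x = y + unitv d i ↔ y = x - unitv d i := fun y =>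
    eq_comm.trans eq_sub_iff_add_eq.symm
  have h' : ∀ y : Vert d, (if x = y + unitv d i then ω.1 (y, i) else 0) =
      if y = x - unitv d i then ω.1 (x - unitv d i, i) else 0 := fun y => by
    by_cases hy : y = x - unitv d i
    · rw [if_pos ((h y).2 hy), if_pos hy, hy]
    · rw [if_neg (mt (h y).1 hy), if_neg hy]
  simp only [h', Finset.sum_ite_eq']
  gcongr
  · split_ifs; exacts [le_rfl, (ω.2 _).le]
  · split_ifs; exacts [le_rfl, (ω.2 _).le]

lemma supNat_le_of_cnd_ne_zero {d : ℕ} {ω : EnvSp d} {x y : Vert d} (h : cnd d ω x y ≠ 0) :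
    supNat d x ≤ supNat d y + 1 := by
  obtain ⟨i, -, hi⟩ := Finset.exists_ne_zero_of_sum_ne_zero h
  refine supNat_le_iff.2 fun j => ?_
  have hj : (y j).natAbs ≤ supNat d y := supNat_le_iff.1 le_rfl j
  by_cases h1 : y = x + unitv d i
  · have : y j = x j + if j = i then 1 else 0 := by rw [h1]; rfl
    split_ifs at this <;> omega
  · by_cases h2 : x = y + unitv d i
    · have : x j = y j + if j = i then 1 else 0 := by rw [h2]; rfl
      split_ifs at this <;> omega
    · simp [h1, h2] at hi

lemma IsWalkLaw.measure_eq_zero {d : ℕ} {ω : EnvSp d} {μ : Measure (Path d)}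
    (hμ : IsWalkLaw d ω 0 μ) (n : ℕ) : ∀ x, n < supNat d x → μ {w | w n = x} = 0 := by
  induction n with
  | zero =>
    intro x hx
    rw [hμ.measure_zero, if_neg]
    rintro rfl
    simp [supNat] at hx
  | succ n ih =>
    intro y hy
    rw [hμ.measure_succ, ENNReal.tsum_eq_zero]
    intro x
    by_cases hxy : cnd d ω y x = 0
    · simp [transP, cnd_comm d ω x y, hxy]
    · rw [ih x (by have := supNat_le_of_cnd_ne_zero hxy; omega), zero_mul]

lemma IsWalkLaw.real_succ {d : ℕ} {ω : EnvSp d} {μ : Measure (Path d)}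
    (hμ : IsWalkLaw d ω 0 μ) {k n : ℕ} (hk : k ≤ n) (y : Vert d) :
    μ.real {w | w (k + 1) = y} =
      ∑ x : box d (n : ℝ), μ.real {w | w k = x} * (cnd d ω x y / piOf d ω x) := by
  have := hμ.1
  rw [Measure.real, hμ.measure_succ, tsum_eq_sum (s := box d (n : ℝ)), ENNReal.toReal_sum,
    Finset.sum_coe_sort (box d (n : ℝ))
      fun x => μ.real {w | w k = x} * (cnd d ω x y / piOf d ω x)]
  · refine Finset.sum_congr rfl fun x _ => ?_
    rw [ENNReal.toReal_mul, ENNReal.toReal_ofReal]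
    · rfl
    · exact div_nonneg (cnd_nonneg _ _ _ _)
        (Finset.sum_nonneg fun i _ => add_nonneg (ω.2 _).le (ω.2 _).le)
  · exact fun x _ => ENNReal.mul_ne_top (measure_ne_top _ _) ENNReal.ofReal_ne_top
  · intro x hx
    rw [mem_box_iff, not_le] at hx
    rw [hμ.measure_eq_zero k x (by omega), zero_mul]

/-- Gaussian tail bound for the walk, in terms of the total weight of the box it can reach. -/
lemma IsWalkLaw.real_tail_le {d : ℕ} (hd : 1 ≤ d) {ω : EnvSp d} {μ : Measure (Path d)}
    (hμ : IsWalkLaw d ω 0 μ) (n : ℕ) (r l : ℝ) (hl : 0 < l) (hl1 : l ≤ 1) :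
    μ.real {w | r < supNat d (w n)} ≤
      √((∑ x ∈ box d (n : ℝ), piOf d ω x) / piOf d ω 0) *
        (2 / l * Real.exp (-(l * r) + 2 * l ^ 2 * n)) := by
  have := hμ.1
  have h0 : (0 : Vert d) ∈ box d (n : ℝ) := by rw [mem_box_iff]; simp [supNat]
  have hmain := sum_tail_le_of_reversible (α := box d (n : ℝ)) (fun x y => cnd d ω x y)
    (fun x => piOf d ω x) (fun x y => cnd_nonneg d ω x y) (fun x y => cnd_comm d ω x y)
    (fun x => piOf_pos d hd ω x)
    (fun x => (Finset.sum_coe_sort (box d (n : ℝ)) fun y => cnd d ω x y).trans_le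
      (sum_cnd_le d ω _ x))
    (fun x => supNat d x) (fun x y => supNat_le_of_cnd_ne_zero) ⟨0, h0⟩ (by simp [supNat])
    n (fun k x => μ.real {w | w k = x})
    (fun x => by
      rw [Measure.real, hμ.measure_zero]
      simp only [Subtype.ext_iff]
      split_ifs <;> simp)
    (fun k hk y => hμ.real_succ hk.le y) r l hl hl1
  rw [Finset.sum_coe_sort (box d (n : ℝ)) fun x => piOf d ω x] at hmain
  refine le_trans ?_ hmain
  have hsub : {w : Path d | r < supNat d (w n)} ⊆
      (⋃ x ∈ (Finset.univ.filter fun x : box d (n : ℝ) => r < supNat d x),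
        {w : Path d | w n = x}) ∪ ⋃ x ∈ {x : Vert d | n < supNat d x}, {w : Path d | w n = x} := by
    intro w hw
    by_cases hn : supNat d (w n) ≤ n
    · refine Or.inl (Set.mem_iUnion₂.2 ⟨⟨w n, mem_box_iff.2 hn⟩, ?_, rfl⟩)
      simpa using hw
    · exact Or.inr (Set.mem_iUnion₂.2 ⟨w n, not_le.1 hn, rfl⟩)
  have hnull : μ.real (⋃ x ∈ {x : Vert d | n < supNat d x}, {w : Path d | w n = x}) = 0 := by
    have h : μ (⋃ x ∈ {x : Vert d | n < supNat d x}, {w : Path d | w n = x}) = 0 :=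
      (measure_biUnion_null_iff (Set.to_countable _)).2 fun x hx => hμ.measure_eq_zero n x hx
    rw [Measure.real, h, ENNReal.toReal_zero]
  refine (measureReal_mono hsub).trans ((measureReal_union_le _ _).trans ?_)
  rw [hnull, add_zero]
  exact measureReal_biUnion_finset_le _ _

lemma card_box (d n : ℕ) : (box d (n : ℝ)).card = (2 * n + 1) ^ d := by
  rw [box, Fintype.card_piFinset]
  simp only [Int.ceil_neg, Int.floor_natCast, Int.card_Icc, Finset.prod_const,
    Finset.card_univ, Fintype.card_fin]
  congr 1
  omega

/-- A moment bound on the conductances forces polynomial growth of the reversible measure. -/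
lemma sum_piOf_le {d : ℕ} {ω : EnvSp d} {p C : ℝ} (hp : 1 ≤ p) {n : ℕ} (hn : 1 ≤ n)
    (hC : (∑ e ∈ edgesIn d (box d (n : ℝ)), ω.1 e ^ p) / (n : ℝ) ^ d ≤ C) :
    ∑ x ∈ box d (n : ℝ), piOf d ω x ≤ 3 ^ d * (2 * d * (1 + C)) * (n : ℝ) ^ (2 * d) := by
  have hn1 : (1 : ℝ) ≤ n := by exact_mod_cast hn
  have hnd : (1 : ℝ) ≤ (n : ℝ) ^ d := one_le_pow₀ hn1
  have hedge : ∀ e ∈ edgesIn d (box d (n : ℝ)), ω.1 e ≤ (1 + C) * (n : ℝ) ^ d := by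
    intro e he
    have h1 : ω.1 e ^ p ≤ C * (n : ℝ) ^ d := by
      rw [div_le_iff₀ (by positivity)] at hC
      exact (Finset.single_le_sum (f := fun e => ω.1 e ^ p)
        (fun e _ => Real.rpow_nonneg (ω.2 e).le _) he).trans hC
    have h2 : ω.1 e ≤ 1 + ω.1 e ^ p := by
      rcases le_total (ω.1 e) 1 with h | h
      · linarith [Real.rpow_nonneg (ω.2 e).le p]
      · linarith [Real.self_le_rpow_of_one_le h hp]
    linarith
  have hpi : ∀ x ∈ box d (n : ℝ), piOf d ω x ≤ 2 * d * (1 + C) * (n : ℝ) ^ d := by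
    intro x hx
    calc piOf d ω x ≤ ∑ _i : Fin d, 2 * ((1 + C) * (n : ℝ) ^ d) := by
          refine Finset.sum_le_sum fun i _ => ?_
          have h1 := hedge (x, i) (Finset.mem_biUnion.2 ⟨x, hx, by simp⟩)
          have h2 := hedge (x - unitv d i, i) (Finset.mem_biUnion.2 ⟨x, hx, by simp⟩)
          linarith
      _ = _ := by simp; ring
  have hpi0 : 0 ≤ 2 * d * (1 + C) * (n : ℝ) ^ d :=
    (Finset.sum_nonneg fun i _ => add_nonneg (ω.2 _).le (ω.2 _).le).trans
      (hpi 0 (by rw [mem_box_iff]; simp [supNat]))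
  calc ∑ x ∈ box d (n : ℝ), piOf d ω x
      ≤ (box d (n : ℝ)).card • (2 * d * (1 + C) * (n : ℝ) ^ d) := Finset.sum_le_card_nsmul _ _ _ hpi
    _ = (2 * n + 1 : ℝ) ^ d * (2 * d * (1 + C) * (n : ℝ) ^ d) := by
        rw [card_box, nsmul_eq_mul]; push_cast; ring
    _ ≤ (3 * n : ℝ) ^ d * (2 * d * (1 + C) * (n : ℝ) ^ d) := by
        gcongr
        linarith
    _ = _ := by rw [mul_pow]; ring

lemma tendsto_const_mul_pow_mul_exp_neg_mul (K c : ℝ) (hc : 0 < c) (m : ℕ) :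
    Tendsto (fun n : ℕ => K * ((n : ℝ) ^ m * Real.exp (-(c * n)))) atTop (𝓝 0) := by
  have h := (tendsto_pow_const_mul_const_pow_of_abs_lt_one m (r := Real.exp (-c))
    (by rw [abs_of_pos (Real.exp_pos _)]; exact Real.exp_lt_one_iff.2 (by linarith))).const_mul K
  rw [mul_zero] at h
  refine h.congr fun n => ?_
  rw [← Real.exp_nat_mul]
  ring_nf

/-- STATEMENT 10 (Corollary 4.2): zero speed. -/
theorem statement10 (d : ℕ) (hd : 1 ≤ d) (p q : ℝ) (hp : 1 < p) (hq : 1 < q)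
    (hpq : 2 ≤ d → 1 / p + 1 / q < 2 / (d : ℝ))
    (ω : EnvSp d) (hstar : InOmegaStar d ω) (hmom : InOmegaPQ d p q ω)
    (μ : Measure (Path d)) (hμ : IsWalkLaw d ω 0 μ) :
    ∀ ε : ℝ, 0 < ε →
      Tendsto (fun n : ℕ => μ {w | ε < ‖(n : ℝ)⁻¹ • ivert d (w n)‖}) atTop
        (𝓝 (0 : ℝ≥0∞)) := by
  intro ε hε
  have := hμ.1
  obtain ⟨C, hC⟩ := hmom.1
  set l : ℝ := min (ε / 4) 1 with hl
  have hl0 : 0 < l := lt_min (by linarith) one_pos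
  have hl1 : l ≤ 1 := min_le_right _ _
  have hlε : 4 * l ≤ ε := by linarith [min_le_left (ε / 4) 1]
  have hπ := piOf_pos d hd ω 0
  set M : ℝ := 3 ^ d * (2 * d * (1 + C)) / piOf d ω 0 with hM
  have hbound : ∀ n : ℕ, 1 ≤ n → μ.real {w | ε < ‖(n : ℝ)⁻¹ • ivert d (w n)‖} ≤
      √M * (2 / l) * ((n : ℝ) ^ d * Real.exp (-(2 * l ^ 2 * n))) := by
    intro n hn
    have hn0 : (0 : ℝ) < n := by exact_mod_cast hn
    have hset : {w : Path d | ε < ‖(n : ℝ)⁻¹ • ivert d (w n)‖} =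
        {w : Path d | ε * n < supNat d (w n)} := by
      ext w
      rw [Set.mem_ofPred_eq, Set.mem_ofPred_eq, norm_smul, norm_ivert, norm_inv, Real.norm_natCast,
        inv_mul_eq_div, lt_div_iff₀ hn0]
    rw [hset]
    refine (hμ.real_tail_le hd n (ε * n) l hl0 hl1).trans ?_
    have hsqrt : √((∑ x ∈ box d (n : ℝ), piOf d ω x) / piOf d ω 0) ≤ √M * (n : ℝ) ^ d := by
      rw [← Real.sqrt_sq (pow_nonneg hn0.le d), ← Real.sqrt_mul' _ (sq_nonneg _)]
      refine Real.sqrt_le_sqrt ?_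
      rw [hM, div_mul_eq_mul_div, ← pow_mul, mul_comm d 2]
      gcongr
      exact sum_piOf_le hp.le hn (hC n hn)
    have hexp : Real.exp (-(l * (ε * n)) + 2 * l ^ 2 * n) ≤ Real.exp (-(2 * l ^ 2 * n)) := by
      refine Real.exp_le_exp.2 ?_
      have : l * n * (4 * l) ≤ l * n * ε := by gcongr
      linarith
    calc _ ≤ √M * (n : ℝ) ^ d * (2 / l * Real.exp (-(2 * l ^ 2 * n))) := by gcongr
      _ = _ := by ring
  have hreal : Tendsto (fun n : ℕ => μ.real {w | ε < ‖(n : ℝ)⁻¹ • ivert d (w n)‖}) atTop (𝓝 0) :=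
    tendsto_of_tendsto_of_tendsto_of_le_of_le' tendsto_const_nhds
      (tendsto_const_mul_pow_mul_exp_neg_mul _ (2 * l ^ 2) (by positivity) d)
      (Eventually.of_forall fun n => measureReal_nonneg)
      (eventually_atTop.2 ⟨1, hbound⟩)
  have h := ENNReal.tendsto_ofReal hreal
  rw [ENNReal.ofReal_zero] at h
  exact h.congr fun n => ofReal_measureReal


end DetCond
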